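/- There exists an absolute constant C > 0 with the following property. Let n, d ≥ 1 and let r, s : ℤ → ℝ be even functions with r(0) = s(0) = 1, |r(k)| ≤ 1 for all k, and Σ_{k∈ℤ} s(k)² < ∞. Let (X_{ik})_{1≤i≤n, 1≤k≤d} be jointly Gaussian centered random variables with E[X_{ik} X_{jl}] = r(i−j) s(k−l), and set W̃_{ij} = d^{-1/2} Σ_{k=1}^d ( X_{ik} X_{jk} − r(i−j) ). Let (G_{ij})_{1≤i≤j≤n} be jointly Gaussian centered random variables with E[G_{ij} G_{uv}] = ( r(i−u) r(v−j) + r(i−v) r(u−j) ) · d^{-1} Σ_{k,l=1}^d s(k−l)². Then for every twice continuously differentiable g : ℝ^{n(n+1)/2} → ℝ all of whose second partial derivatives are bounded in absolute value by 1, |E[g((W̃_{ij})_{i≤j})] − E[g((G_{ij})_{i≤j})]| ≤ C · n⁴ · d^{-1/2} · ( Σ_{|k|≤d} |s(k)|^{4/3} )^{3/2}. -/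

import Mathlib

open MeasureTheory ProbabilityTheory

/-- A family of real random variables is jointly Gaussian and centered if every finite
linear combination of its members has a centered Gaussian law. -/
def IsCenteredGaussianFamily {Ω : Type*} [MeasureSpace Ω] {ι : Type*} (X : ι → Ω → ℝ) : Prop :=
  ∀ (S : Finset ι) (c : ι → ℝ), ∃ v : NNReal,
    Measure.map (fun ω => ∑ i ∈ S, c i * X i ω) volume = gaussianReal 0 v

/-- A function between normed spaces has polynomial growth if its norm is bounded by a multiple
of a power of `1 + ‖x‖`. -/
def PolyGrowth {E F : Type*} [NormedAddCommGroup E] [NormedAddCommGroup F] (f : E → F) : Prop :=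
  ∃ (C : ℝ) (k : ℕ), 0 ≤ C ∧ ∀ x, ‖f x‖ ≤ C * (1 + ‖x‖) ^ k

namespace PolyGrowth

variable {E F G : Type*} [NormedAddCommGroup E] [NormedAddCommGroup F] [NormedAddCommGroup G]

lemma const (c : F) : PolyGrowth (fun _ : E => c) :=
  ⟨‖c‖, 0, norm_nonneg _, fun x => by simp⟩

lemma id : PolyGrowth (fun x : E => x) :=
  ⟨1, 1, zero_le_one, fun x => by simp⟩

lemma mono {f : E → F} {g : E → G} (hg : PolyGrowth g) (h : ∀ x, ‖f x‖ ≤ ‖g x‖) :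
    PolyGrowth f := by
  obtain ⟨C, k, hC, hk⟩ := hg
  exact ⟨C, k, hC, fun x => (h x).trans (hk x)⟩

lemma norm {f : E → F} (hf : PolyGrowth f) : PolyGrowth (fun x => ‖f x‖) :=
  hf.mono fun x => by simp

lemma add {f g : E → F} (hf : PolyGrowth f) (hg : PolyGrowth g) :
    PolyGrowth (fun x => f x + g x) := by
  obtain ⟨C, k, hC, hk⟩ := hf
  obtain ⟨D, l, hD, hl⟩ := hg
  refine ⟨C + D, max k l, by positivity, fun x => (norm_add_le _ _).trans ?_⟩
  have h1 : (1 : ℝ) ≤ 1 + ‖x‖ := by simp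
  rw [add_mul]
  refine add_le_add ((hk x).trans ?_) ((hl x).trans ?_)
  · gcongr
    exact le_max_left _ _
  · gcongr
    exact le_max_right _ _

lemma mul {f g : E → ℝ} (hf : PolyGrowth f) (hg : PolyGrowth g) :
    PolyGrowth (fun x => f x * g x) := by
  obtain ⟨C, k, hC, hk⟩ := hf
  obtain ⟨D, l, hD, hl⟩ := hg
  refine ⟨C * D, k + l, by positivity, fun x => ?_⟩
  calc ‖f x * g x‖ = ‖f x‖ * ‖g x‖ := norm_mul _ _
    _ ≤ (C * (1 + ‖x‖) ^ k) * (D * (1 + ‖x‖) ^ l) := by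
        gcongr
        · exact hk x
        · exact hl x
    _ = _ := by ring

lemma sum {ι : Type*} (s : Finset ι) {f : ι → E → F} (hf : ∀ i ∈ s, PolyGrowth (f i)) :
    PolyGrowth (fun x => ∑ i ∈ s, f i x) := by
  classical
  induction s using Finset.induction_on with
  | empty => simpa using const (E := E) (0 : F)
  | insert a s ha ih =>
    simp only [Finset.sum_insert ha]
    exact (hf a (by simp)).add (ih fun i hi => hf i (by simp [hi]))

lemma pow {f : E → ℝ} (hf : PolyGrowth f) (m : ℕ) : PolyGrowth (fun x => f x ^ m) := by
  induction m with
  | zero => simpa using const (E := E) (1 : ℝ)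
  | succ m ih => simpa only [pow_succ] using ih.mul hf

lemma comp {g : F → G} {f : E → F} (hg : PolyGrowth g) (hf : PolyGrowth f) :
    PolyGrowth (fun x => g (f x)) := by
  obtain ⟨C, k, hC, hk⟩ := hg
  have h : PolyGrowth (fun x => C * (1 + ‖f x‖) ^ k) :=
    (const C).mul (((const 1).add hf.norm).pow k)
  exact h.mono fun x => (hk (f x)).trans (le_abs_self _)

lemma continuousLinearMap [NormedSpace ℝ E] [NormedSpace ℝ F] (L : E →L[ℝ] F) :
    PolyGrowth (fun x => L x) :=
  ((const (E := E) ‖L‖).mul id.norm).mono fun x =>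
    (L.le_opNorm x).trans (le_abs_self _)

lemma clm_apply [NormedSpace ℝ F] [NormedSpace ℝ G] {L : E → F →L[ℝ] G} {f : E → F}
    (hL : PolyGrowth L) (hf : PolyGrowth f) : PolyGrowth (fun x => L x (f x)) :=
  (hL.norm.mul hf.norm).mono fun x => ((L x).le_opNorm _).trans (le_abs_self _)

lemma of_fderiv [NormedSpace ℝ E] [NormedSpace ℝ F] {f : E → F} (hf : Differentiable ℝ f)
    (h : PolyGrowth (fderiv ℝ f)) : PolyGrowth f := by
  obtain ⟨C, k, hC, hk⟩ := h
  have hb : PolyGrowth (fun x : E => ‖f 0‖ + C * (1 + ‖x‖) ^ k * ‖x‖) :=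
    (const _).add (((const C).mul (((const 1).add id.norm).pow k)).mul id.norm)
  refine hb.mono fun x => le_trans ?_ (le_abs_self _)
  have h1 := (convex_closedBall (0 : E) ‖x‖).norm_image_sub_le_of_norm_fderiv_le (𝕜 := ℝ)
    (f := f) (C := C * (1 + ‖x‖) ^ k) (fun y _ => hf y)
    (fun y hy => (hk y).trans (by
      have : ‖y‖ ≤ ‖x‖ := by simpa using hy
      gcongr)) (x := 0) (y := x) (by simp) (by simp)
  rw [sub_zero] at h1
  have h2 := norm_sub_norm_le (f x) (f 0)
  linarith

lemma integrable [NormedSpace ℝ E] [MeasurableSpace E] [BorelSpace E] [CompleteSpace E]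
    [SecondCountableTopology E] {μ : Measure E} [IsGaussian μ] [NormedSpace ℝ F]
    {f : E → F} (hf : PolyGrowth f) (hc : Continuous f) : Integrable f μ := by
  obtain ⟨C, k, hC, hk⟩ := hf
  have h1 : MemLp (fun x : E => ‖x‖) k μ :=
    (IsGaussian.memLp_id μ k (ENNReal.natCast_ne_top k)).norm
  have h2 : MemLp (fun x : E => 1 + ‖x‖) k μ := (memLp_const (1 : ℝ)).add h1
  refine (h2.integrable_norm_pow'.const_mul C).mono' hc.aestronglyMeasurable
    (Filter.Eventually.of_forall fun x => ?_)
  refine (hk x).trans_eq ?_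
  rw [Real.norm_of_nonneg (by positivity)]

end PolyGrowth

/-- A continuously differentiable function whose derivative has polynomial growth. -/
def C1PolyGrowth {E F : Type*} [NormedAddCommGroup E] [NormedSpace ℝ E] [NormedAddCommGroup F]
    [NormedSpace ℝ F] (f : E → F) : Prop :=
  ContDiff ℝ 1 f ∧ PolyGrowth (fderiv ℝ f)

namespace C1PolyGrowth

variable {E F G : Type*} [NormedAddCommGroup E] [NormedSpace ℝ E] [NormedAddCommGroup F]
  [NormedSpace ℝ F] [NormedAddCommGroup G] [NormedSpace ℝ G]

lemma differentiable {f : E → F} (hf : C1PolyGrowth f) : Differentiable ℝ f :=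
  hf.1.differentiable (by simp)

lemma continuous {f : E → F} (hf : C1PolyGrowth f) : Continuous f := hf.1.continuous

lemma continuous_fderiv {f : E → F} (hf : C1PolyGrowth f) : Continuous (fderiv ℝ f) :=
  hf.1.continuous_fderiv (by simp)

lemma polyGrowth {f : E → F} (hf : C1PolyGrowth f) : PolyGrowth f :=
  .of_fderiv hf.differentiable hf.2

lemma const (c : F) : C1PolyGrowth (fun _ : E => c) :=
  ⟨contDiff_const, (PolyGrowth.const (0 : E →L[ℝ] F)).mono fun x => by simp⟩

lemma continuousLinearMap (L : E →L[ℝ] F) : C1PolyGrowth (fun x => L x) :=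
  ⟨L.contDiff, (PolyGrowth.const (E := E) L).mono fun x => by simp⟩

lemma add {f g : E → F} (hf : C1PolyGrowth f) (hg : C1PolyGrowth g) :
    C1PolyGrowth (fun x => f x + g x) := by
  refine ⟨hf.1.add hg.1, (hf.2.add hg.2).mono fun x => le_of_eq ?_⟩
  rw [fderiv_fun_add (hf.differentiable x) (hg.differentiable x)]

lemma mul {f g : E → ℝ} (hf : C1PolyGrowth f) (hg : C1PolyGrowth g) :
    C1PolyGrowth (fun x => f x * g x) := by
  refine ⟨hf.1.mul hg.1, ((hf.polyGrowth.norm.mul hg.2.norm).add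
    (hg.polyGrowth.norm.mul hf.2.norm)).mono fun x => ?_⟩
  rw [fderiv_fun_mul (hf.differentiable x) (hg.differentiable x)]
  refine (norm_add_le _ _).trans (le_trans (le_of_eq ?_) (le_abs_self _))
  rw [norm_smul, norm_smul]

lemma sum {ι : Type*} (s : Finset ι) {f : ι → E → F} (hf : ∀ i ∈ s, C1PolyGrowth (f i)) :
    C1PolyGrowth (fun x => ∑ i ∈ s, f i x) := by
  classical
  induction s using Finset.induction_on with
  | empty => simpa using const (E := E) (0 : F)
  | insert a s ha ih =>
    simp only [Finset.sum_insert ha]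
    exact (hf a (by simp)).add (ih fun i hi => hf i (by simp [hi]))

lemma comp {g : F → G} {f : E → F} (hg : C1PolyGrowth g) (hf : C1PolyGrowth f) :
    C1PolyGrowth (fun x => g (f x)) := by
  refine ⟨hg.1.comp hf.1, ((hg.2.comp hf.polyGrowth).norm.mul hf.2.norm).mono fun x => ?_⟩
  rw [show (fun x => g (f x)) = g ∘ f from rfl,
    fderiv_comp x (hg.differentiable (f x)) (hf.differentiable x)]
  exact (ContinuousLinearMap.opNorm_comp_le _ _).trans (le_abs_self _)

lemma pi {ι : Type*} [Fintype ι] {f : E → ι → ℝ} (hf : ∀ i, C1PolyGrowth (fun x => f x i)) :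
    C1PolyGrowth f := by
  refine ⟨contDiff_pi.2 fun i => (hf i).1,
    (PolyGrowth.sum Finset.univ fun i _ => (hf i).2.norm).mono fun x => ?_⟩
  refine le_trans ?_ (le_abs_self _)
  rw [fderiv_pi fun i => (hf i).differentiable x]
  refine ContinuousLinearMap.opNorm_le_bound _ (by positivity) fun v => ?_
  refine (pi_norm_le_iff_of_nonneg (by positivity)).2 fun i => ?_
  rw [ContinuousLinearMap.pi_apply]
  refine (ContinuousLinearMap.le_opNorm _ v).trans ?_
  gcongr
  exact Finset.single_le_sum (f := fun i => ‖fderiv ℝ (fun x => f x i) x‖)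
    (fun _ _ => norm_nonneg _) (Finset.mem_univ i)

end C1PolyGrowth

section Gaussian

variable {E : Type*} [NormedAddCommGroup E] [NormedSpace ℝ E] [MeasurableSpace E] [BorelSpace E]
  [CompleteSpace E] [SecondCountableTopology E] {μ : Measure E} [IsGaussian μ]

/-- Differentiation under the Gaussian integral along a trigonometric path. -/
lemma hasDerivAt_integral_cos_add_sin {V : Type*} [NormedAddCommGroup V] [NormedSpace ℝ V]
    {F : V → ℝ} (hF : C1PolyGrowth F) {a b : E → V} (ha : PolyGrowth a) (hac : Continuous a)
    (hb : PolyGrowth b) (hbc : Continuous b) (θ : ℝ) :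
    HasDerivAt (fun t => ∫ z, F (Real.cos t • a z + Real.sin t • b z) ∂μ)
      (∫ z, fderiv ℝ F (Real.cos θ • a z + Real.sin θ • b z)
        (-Real.sin θ • a z + Real.cos θ • b z) ∂μ) θ := by
  have hle : ∀ (t : ℝ) (z : E), ‖Real.cos t • a z + Real.sin t • b z‖ ≤ ‖a z‖ + ‖b z‖ := by
    intro t z
    refine (norm_add_le _ _).trans (add_le_add ?_ ?_)
    · rw [norm_smul]
      exact mul_le_of_le_one_left (norm_nonneg _) (Real.abs_cos_le_one t)
    · rw [norm_smul]
      exact mul_le_of_le_one_left (norm_nonneg _) (Real.abs_sin_le_one t)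
  have hle' : ∀ (t : ℝ) (z : E), ‖-Real.sin t • a z + Real.cos t • b z‖ ≤ ‖a z‖ + ‖b z‖ := by
    intro t z
    refine (norm_add_le _ _).trans (add_le_add ?_ ?_)
    · rw [norm_smul, norm_neg]
      exact mul_le_of_le_one_left (norm_nonneg _) (Real.abs_sin_le_one t)
    · rw [norm_smul]
      exact mul_le_of_le_one_left (norm_nonneg _) (Real.abs_cos_le_one t)
  obtain ⟨C, k, hC, hk⟩ := hF.2
  have hpg : PolyGrowth (fun z => ‖a z‖ + ‖b z‖) := ha.norm.add hb.norm
  have hbound : Integrable (fun z => C * (1 + (‖a z‖ + ‖b z‖)) ^ k * (‖a z‖ + ‖b z‖)) μ :=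
    PolyGrowth.integrable
      (((PolyGrowth.const C).mul (((PolyGrowth.const 1).add hpg).pow k)).mul hpg) (by fun_prop)
  have hFc := hF.continuous
  have hFc' := hF.continuous_fderiv
  refine (hasDerivAt_integral_of_dominated_loc_of_deriv_le (s := Set.univ) (μ := μ)
    (F := fun t z => F (Real.cos t • a z + Real.sin t • b z))
    (F' := fun t z => fderiv ℝ F (Real.cos t • a z + Real.sin t • b z)
        (-Real.sin t • a z + Real.cos t • b z)) Filter.univ_mem ?_ ?_ ?_ ?_ hbound ?_).2
  · exact Filter.Eventually.of_forall fun t =>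
      (by fun_prop : Continuous _).aestronglyMeasurable
  · refine PolyGrowth.integrable (hF.polyGrowth.comp (hpg.mono fun z => ?_)) (by fun_prop)
    exact (hle θ z).trans (le_abs_self _)
  · exact (by fun_prop : Continuous _).aestronglyMeasurable
  · refine Filter.Eventually.of_forall fun z t _ => ?_
    refine (ContinuousLinearMap.le_opNorm _ _).trans ?_
    refine mul_le_mul ((hk _).trans ?_) (hle' t z) (norm_nonneg _) (by positivity)
    gcongr
    exact hle t z
  · refine Filter.Eventually.of_forall fun z t _ => ?_
    have h1 : HasDerivAt (fun t : ℝ => Real.cos t • a z + Real.sin t • b z)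
        (-Real.sin t • a z + Real.cos t • b z) t :=
      ((Real.hasDerivAt_cos t).smul_const (a z)).add ((Real.hasDerivAt_sin t).smul_const (b z))
    exact ((hF.differentiable _).hasFDerivAt).comp_hasDerivAt t h1

/-- Gaussian integration by parts for a centered Gaussian measure. -/
lemma integral_dual_mul_eq_integral_fderiv (hμ : ∫ x, x ∂μ = 0) (ℓ : E →L[ℝ] ℝ) {h : E → ℝ}
    (hh : C1PolyGrowth h) :
    ∫ x, ℓ x * h x ∂μ = ∫ x, fderiv ℝ h x (∫ y, ℓ y • y ∂μ) ∂μ := by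
  let F : E × E → ℝ := fun p => ℓ p.2 * h p.1
  have hℓ2 : C1PolyGrowth (fun p : E × E => ℓ p.2) :=
    C1PolyGrowth.continuousLinearMap (ℓ ∘L ContinuousLinearMap.snd ℝ E E)
  have hh1 : C1PolyGrowth (fun p : E × E => h p.1) :=
    hh.comp (C1PolyGrowth.continuousLinearMap (ContinuousLinearMap.fst ℝ E E))
  have hF : C1PolyGrowth F := hℓ2.mul hh1
  have hb : Continuous (fun p : E × E => (p.2, -p.1)) := by fun_prop
  have hbp : PolyGrowth (fun p : E × E => (p.2, -p.1)) :=
    PolyGrowth.id.mono fun p => by simp [Prod.norm_def, max_comm]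
  have key := hasDerivAt_integral_cos_add_sin (μ := μ.prod μ) hF PolyGrowth.id continuous_id
    hbp hb 0
  have hconst : (fun t => ∫ z, F (Real.cos t • z + Real.sin t • (z.2, -z.1)) ∂(μ.prod μ))
      = fun _ => ∫ z, F z ∂(μ.prod μ) := by
    ext t
    have hrot := IsGaussian.map_rotation_eq_self (μ := μ) (by simpa using hμ) t
    conv_rhs => rw [← hrot]
    rw [integral_map (by fun_prop) hF.continuous.aestronglyMeasurable]
    refine integral_congr_ae (Filter.Eventually.of_forall fun z => ?_)
    simp only [ContinuousLinearMap.rotation_apply]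
    congr 1
    ext <;> simp [add_comm]
  have h0 := key.unique (hconst ▸ hasDerivAt_const (0 : ℝ) _)
  have hder : ∀ z : E × E, fderiv ℝ F z (z.2, -z.1) =
      ℓ z.2 * fderiv ℝ h z.1 z.2 - ℓ z.1 * h z.1 := by
    intro z
    have h1 : HasFDerivAt (fun p : E × E => ℓ p.2) (ℓ ∘L ContinuousLinearMap.snd ℝ E E) z :=
      (ℓ ∘L ContinuousLinearMap.snd ℝ E E).hasFDerivAt
    have h2 : HasFDerivAt (fun p : E × E => h p.1)
        ((fderiv ℝ h z.1) ∘L ContinuousLinearMap.fst ℝ E E) z :=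
      HasFDerivAt.comp z (hh.differentiable z.1).hasFDerivAt hasFDerivAt_fst
    rw [show fderiv ℝ F z = _ from (h1.mul h2).fderiv]
    simp
    ring
  have hi1 : Integrable (fun z : E × E => ℓ z.2 * fderiv ℝ h z.1 z.2) (μ.prod μ) := by
    have hc := hh.continuous_fderiv
    refine PolyGrowth.integrable (hℓ2.polyGrowth.mul ?_) (by fun_prop)
    exact PolyGrowth.clm_apply
      (hh.2.comp (PolyGrowth.continuousLinearMap (ContinuousLinearMap.fst ℝ E E)))
      (PolyGrowth.continuousLinearMap (ContinuousLinearMap.snd ℝ E E))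
  have hi2 : Integrable (fun x : E => ℓ x * h x) μ := by
    have hc := hh.continuous
    exact PolyGrowth.integrable ((PolyGrowth.continuousLinearMap ℓ).mul hh.polyGrowth)
      (by fun_prop)
  have hsplit : ∫ z, fderiv ℝ F z (z.2, -z.1) ∂(μ.prod μ) =
      ∫ x, fderiv ℝ h x (∫ y, ℓ y • y ∂μ) ∂μ - ∫ x, ℓ x * h x ∂μ := by
    simp_rw [hder]
    rw [integral_sub hi1 (hi2.comp_fst μ), integral_prod _ hi1,
      integral_fun_fst (fun x => ℓ x * h x)]
    simp only [probReal_univ, one_smul]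
    congr 1
    refine integral_congr_ae (Filter.Eventually.of_forall fun x => ?_)
    have hi3 : Integrable (fun y : E => ℓ y • y) μ := by
      refine PolyGrowth.integrable ?_ (by fun_prop)
      refine ((PolyGrowth.continuousLinearMap ℓ).norm.mul PolyGrowth.id.norm).mono fun y => ?_
      simp [norm_smul]
    simp only []
    rw [← ContinuousLinearMap.integral_comp_comm _ hi3]
    simp
  simp only [Real.cos_zero, Real.sin_zero, one_smul, zero_smul, add_zero, neg_zero, zero_add]
    at h0
  rw [hsplit] at h0
  linarith

lemma dual_apply_integral_smul (ℓ ℓ' : E →L[ℝ] ℝ) :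
    ℓ' (∫ y, ℓ y • y ∂μ) = ∫ y, ℓ y * ℓ' y ∂μ := by
  have hi : Integrable (fun y : E => ℓ y • y) μ := by
    refine PolyGrowth.integrable ?_ (by fun_prop)
    refine ((PolyGrowth.continuousLinearMap ℓ).norm.mul PolyGrowth.id.norm).mono fun y => ?_
    simp [norm_smul]
  rw [← ContinuousLinearMap.integral_comp_comm _ hi]
  simp

/-- Integration by parts for a centered product of two Gaussian linear functionals. -/
lemma integral_dual_mul_dual_sub_mul (hμ : ∫ x, x ∂μ = 0) (ℓ₁ ℓ₂ : E →L[ℝ] ℝ) {h : E → ℝ}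
    (hh : C1PolyGrowth h) :
    ∫ x, (ℓ₁ x * ℓ₂ x - ∫ y, ℓ₁ y * ℓ₂ y ∂μ) * h x ∂μ =
      ∫ x, ℓ₂ x * fderiv ℝ h x (∫ y, ℓ₁ y • y ∂μ) ∂μ := by
  have hℓ := C1PolyGrowth.continuousLinearMap ℓ₂
  have hibp := integral_dual_mul_eq_integral_fderiv hμ ℓ₁ (hℓ.mul hh)
  have hd : ∀ x, fderiv ℝ (fun x => ℓ₂ x * h x) x (∫ y, ℓ₁ y • y ∂μ) =
      ℓ₂ x * fderiv ℝ h x (∫ y, ℓ₁ y • y ∂μ) + (∫ y, ℓ₁ y * ℓ₂ y ∂μ) * h x := by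
    intro x
    rw [fderiv_fun_mul (hℓ.differentiable x) (hh.differentiable x)]
    simp [dual_apply_integral_smul, mul_comm]
  have hc := hh.continuous
  have hc' := hh.continuous_fderiv
  have hi1 : Integrable (fun x => ℓ₂ x * fderiv ℝ h x (∫ y, ℓ₁ y • y ∂μ)) μ :=
    PolyGrowth.integrable (hℓ.polyGrowth.mul (hh.2.clm_apply (PolyGrowth.const _)))
      (by fun_prop)
  have hi2 : Integrable (fun x => (∫ y, ℓ₁ y * ℓ₂ y ∂μ) * h x) μ :=
    PolyGrowth.integrable ((PolyGrowth.const _).mul hh.polyGrowth) (by fun_prop)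
  have hi3 : Integrable (fun x => ℓ₁ x * (ℓ₂ x * h x)) μ :=
    PolyGrowth.integrable ((PolyGrowth.continuousLinearMap ℓ₁).mul
      (hℓ.polyGrowth.mul hh.polyGrowth)) (by fun_prop)
  simp_rw [hd] at hibp
  rw [integral_add hi1 hi2] at hibp
  simp_rw [sub_mul, mul_assoc]
  rw [integral_sub hi3 hi2, hibp, add_sub_cancel_right]

/-- Covariance of two centered products of Gaussian linear functionals. -/
lemma integral_dual_mul_dual_sub_mul_dual_mul_dual_sub (hμ : ∫ x, x ∂μ = 0)
    (ℓ₁ ℓ₂ ℓ₃ ℓ₄ : E →L[ℝ] ℝ) :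
    ∫ x, (ℓ₁ x * ℓ₂ x - ∫ y, ℓ₁ y * ℓ₂ y ∂μ) * (ℓ₃ x * ℓ₄ x - ∫ y, ℓ₃ y * ℓ₄ y ∂μ) ∂μ =
      (∫ y, ℓ₁ y * ℓ₃ y ∂μ) * (∫ y, ℓ₂ y * ℓ₄ y ∂μ) +
        (∫ y, ℓ₁ y * ℓ₄ y ∂μ) * (∫ y, ℓ₂ y * ℓ₃ y ∂μ) := by
  have h3 := C1PolyGrowth.continuousLinearMap ℓ₃
  have h4 := C1PolyGrowth.continuousLinearMap ℓ₄
  have hh : C1PolyGrowth (fun x => ℓ₃ x * ℓ₄ x - ∫ y, ℓ₃ y * ℓ₄ y ∂μ) := by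
    simpa only [sub_eq_add_neg] using (h3.mul h4).add (C1PolyGrowth.const _)
  rw [integral_dual_mul_dual_sub_mul hμ ℓ₁ ℓ₂ hh]
  have hd : ∀ x, ℓ₂ x * fderiv ℝ (fun x => ℓ₃ x * ℓ₄ x - ∫ y, ℓ₃ y * ℓ₄ y ∂μ) x
      (∫ y, ℓ₁ y • y ∂μ) = (∫ y, ℓ₁ y * ℓ₄ y ∂μ) * (ℓ₂ x * ℓ₃ x) +
        (∫ y, ℓ₁ y * ℓ₃ y ∂μ) * (ℓ₂ x * ℓ₄ x) := by
    intro x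
    rw [fderiv_sub_const, fderiv_fun_mul (h3.differentiable x) (h4.differentiable x)]
    simp [dual_apply_integral_smul]
    ring
  have hi : ∀ ℓ : E →L[ℝ] ℝ, Integrable (fun x => ℓ₂ x * ℓ x) μ := fun ℓ =>
    PolyGrowth.integrable ((PolyGrowth.continuousLinearMap ℓ₂).mul
      (PolyGrowth.continuousLinearMap ℓ)) (by fun_prop)
  simp_rw [hd]
  rw [integral_add ((hi ℓ₃).const_mul _) ((hi ℓ₄).const_mul _), integral_const_mul,
    integral_const_mul, add_comm]

lemma clm_pi_apply_eq_sum {κ : Type*} [Fintype κ] [DecidableEq κ] (L : (κ → ℝ) →L[ℝ] ℝ)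
    (v : κ → ℝ) : L v = ∑ p, v p * L (Pi.single p 1) := by
  conv_lhs => rw [pi_eq_sum_univ' v, map_sum]
  refine Finset.sum_congr rfl fun p _ => ?_
  rw [map_smul, smul_eq_mul]

lemma norm_clm_pi_le_sum {κ : Type*} [Fintype κ] [DecidableEq κ] (L : (κ → ℝ) →L[ℝ] ℝ) :
    ‖L‖ ≤ ∑ p, |L (Pi.single p 1)| := by
  refine ContinuousLinearMap.opNorm_le_bound _ (by positivity) fun v => ?_
  rw [clm_pi_apply_eq_sum L v, Finset.sum_mul]
  refine (norm_sum_le _ _).trans (Finset.sum_le_sum fun p _ => ?_)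
  rw [norm_mul, mul_comm]
  exact mul_le_mul_of_nonneg_left (norm_le_pi_norm v p) (abs_nonneg _)

section SecondOrder

variable {κ : Type*} [Fintype κ] [DecidableEq κ] {g : (κ → ℝ) → ℝ}

lemma C1PolyGrowth.partialDeriv_of_bounded (hg : ContDiff ℝ 2 g)
    (hg2 : ∀ x p q, |fderiv ℝ (fun y => fderiv ℝ g y (Pi.single q 1)) x (Pi.single p 1)| ≤ 1)
    (q : κ) : C1PolyGrowth (fun y => fderiv ℝ g y (Pi.single q 1)) := by
  refine ⟨(hg.fderiv_right (m := 1) (by norm_num)).clm_apply contDiff_const, ?_⟩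
  refine (PolyGrowth.const (Fintype.card κ : ℝ)).mono fun x => ?_
  refine (norm_clm_pi_le_sum _).trans ((Finset.sum_le_sum fun p _ => hg2 x p q).trans ?_)
  simp

lemma C1PolyGrowth.of_bounded_second (hg : ContDiff ℝ 2 g)
    (hg2 : ∀ x p q, |fderiv ℝ (fun y => fderiv ℝ g y (Pi.single q 1)) x (Pi.single p 1)| ≤ 1) :
    C1PolyGrowth g := by
  refine ⟨hg.of_le (by norm_num), (PolyGrowth.sum Finset.univ fun q _ =>
    (C1PolyGrowth.partialDeriv_of_bounded hg hg2 q).polyGrowth.norm).mono fun x => ?_⟩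
  exact (norm_clm_pi_le_sum _).trans (le_abs_self _)

/-- Trigonometric interpolation: if `Φ` and `Y` satisfy Stein identities along the path
`cos θ • Y + sin θ • Φ` with kernels `T` and `C`, then the difference of the expectations of `g`
is controlled by the `L¹` distance between the kernels. -/
lemma abs_integral_sub_integral_le_of_stein (hg : ContDiff ℝ 2 g)
    (hg2 : ∀ x p q, |fderiv ℝ (fun y => fderiv ℝ g y (Pi.single q 1)) x (Pi.single p 1)| ≤ 1)
    {Φ Y : E → κ → ℝ} (hΦ : C1PolyGrowth Φ) (hY : C1PolyGrowth Y) {T : κ → κ → E → ℝ}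
    (hT : ∀ p q, PolyGrowth (T p q)) (hTc : ∀ p q, Continuous (T p q)) (C : κ → κ → ℝ)
    (hΦT : ∀ p (f : (κ → ℝ) → ℝ), C1PolyGrowth f → ∀ θ : ℝ,
      ∫ z, Φ z p * f (Real.cos θ • Y z + Real.sin θ • Φ z) ∂μ =
        Real.sin θ * ∑ q, ∫ z, T p q z *
          fderiv ℝ f (Real.cos θ • Y z + Real.sin θ • Φ z) (Pi.single q 1) ∂μ)
    (hYC : ∀ p (f : (κ → ℝ) → ℝ), C1PolyGrowth f → ∀ θ : ℝ,
      ∫ z, Y z p * f (Real.cos θ • Y z + Real.sin θ • Φ z) ∂μ =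
        Real.cos θ * ∑ q, ∫ z, C p q *
          fderiv ℝ f (Real.cos θ • Y z + Real.sin θ • Φ z) (Pi.single q 1) ∂μ) :
    |∫ z, g (Φ z) ∂μ - ∫ z, g (Y z) ∂μ| ≤ 2 * ∑ p, ∑ q, ∫ z, |T p q z - C p q| ∂μ := by
  have hf := C1PolyGrowth.partialDeriv_of_bounded hg hg2
  have hgP := C1PolyGrowth.of_bounded_second hg hg2
  have hYc := hY.continuous
  have hΦc := hΦ.continuous
  set H : ℝ → E → κ → ℝ := fun θ z => Real.cos θ • Y z + Real.sin θ • Φ z with hH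
  have hHc : ∀ θ, Continuous (H θ) := fun θ => by simp only [hH]; fun_prop
  have hHp : ∀ θ, PolyGrowth (H θ) := fun θ =>
    (((PolyGrowth.const (Real.cos θ)).mul hY.polyGrowth.norm).norm.add
      ((PolyGrowth.const (Real.sin θ)).mul hΦ.polyGrowth.norm).norm).mono fun z => by
        refine (norm_add_le _ _).trans (le_trans (le_of_eq ?_) (le_abs_self _))
        simp [norm_smul]
  have hproj : ∀ {F : E → κ → ℝ}, PolyGrowth F → ∀ p, PolyGrowth (fun z => F z p) :=
    fun hF p => hF.mono fun z => norm_le_pi_norm _ p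
  have hprojc : ∀ {F : E → κ → ℝ}, Continuous F → ∀ p, Continuous (fun z => F z p) :=
    fun hF p => (continuous_apply p).comp hF
  have hinteg : ∀ {F : E → κ → ℝ}, C1PolyGrowth F → ∀ p θ,
      Integrable (fun z => F z p * fderiv ℝ g (H θ z) (Pi.single p 1)) μ := fun hF p θ =>
    PolyGrowth.integrable ((hproj hF.polyGrowth p).mul ((hf p).polyGrowth.comp (hHp θ)))
      ((hprojc hF.continuous p).mul ((hf p).continuous.comp (hHc θ)))
  have hD2p : ∀ p q θ, PolyGrowth (fun z =>
      fderiv ℝ (fun y => fderiv ℝ g y (Pi.single p 1)) (H θ z) (Pi.single q 1)) := fun p q θ =>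
    ((hf p).2.comp (hHp θ)).clm_apply (PolyGrowth.const _)
  have hD2c : ∀ p q θ, Continuous (fun z =>
      fderiv ℝ (fun y => fderiv ℝ g y (Pi.single p 1)) (H θ z) (Pi.single q 1)) := fun p q θ =>
    ((hf p).continuous_fderiv.comp (hHc θ)).clm_apply continuous_const
  have hderiv : ∀ θ, HasDerivAt (fun t => ∫ z, g (H t z) ∂μ)
      (Real.cos θ * Real.sin θ * ∑ p, ∑ q, ∫ z, (T p q z - C p q) *
        fderiv ℝ (fun y => fderiv ℝ g y (Pi.single p 1)) (H θ z) (Pi.single q 1) ∂μ) θ := by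
    intro θ
    convert hasDerivAt_integral_cos_add_sin (μ := μ) hgP hY.polyGrowth hYc hΦ.polyGrowth hΦc θ
      using 1
    have h1 : ∀ z, fderiv ℝ g (Real.cos θ • Y z + Real.sin θ • Φ z)
        (-Real.sin θ • Y z + Real.cos θ • Φ z) =
        ∑ p, (Real.cos θ * (Φ z p * fderiv ℝ g (H θ z) (Pi.single p 1)) -
          Real.sin θ * (Y z p * fderiv ℝ g (H θ z) (Pi.single p 1))) := by
      intro z
      rw [clm_pi_apply_eq_sum]
      refine Finset.sum_congr rfl fun p _ => ?_
      simp [hH]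
      ring
    have h2 : ∀ p ∈ Finset.univ, Integrable (fun z =>
        Real.cos θ * (Φ z p * fderiv ℝ g (H θ z) (Pi.single p 1)) -
          Real.sin θ * (Y z p * fderiv ℝ g (H θ z) (Pi.single p 1))) μ := fun p _ =>
      ((hinteg hΦ p θ).const_mul _).sub ((hinteg hY p θ).const_mul _)
    simp_rw [h1]
    rw [integral_finsetSum _ h2, Finset.mul_sum]
    refine Finset.sum_congr rfl fun p _ => ?_
    rw [integral_sub ((hinteg hΦ p θ).const_mul _) ((hinteg hY p θ).const_mul _),
      integral_const_mul, integral_const_mul, hΦT p _ (hf p) θ, hYC p _ (hf p) θ,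
      ← mul_assoc, ← mul_assoc, mul_comm (Real.sin θ) (Real.cos θ), ← mul_sub,
      ← Finset.sum_sub_distrib]
    congr 1
    refine Finset.sum_congr rfl fun q _ => ?_
    rw [← integral_sub]
    · simp_rw [sub_mul, hH]
    · exact PolyGrowth.integrable ((hT p q).mul (hD2p p q θ)) ((hTc p q).mul (hD2c p q θ))
    · exact PolyGrowth.integrable ((PolyGrowth.const _).mul (hD2p p q θ))
        (continuous_const.mul (hD2c p q θ))
  have hbound : ∀ θ, ‖Real.cos θ * Real.sin θ * ∑ p, ∑ q, ∫ z, (T p q z - C p q) *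
        fderiv ℝ (fun y => fderiv ℝ g y (Pi.single p 1)) (H θ z) (Pi.single q 1) ∂μ‖ ≤
      ∑ p, ∑ q, ∫ z, |T p q z - C p q| ∂μ := by
    intro θ
    rw [norm_mul]
    have hcs : ‖Real.cos θ * Real.sin θ‖ ≤ 1 := by
      rw [norm_mul]
      exact mul_le_one₀ (Real.abs_cos_le_one θ) (norm_nonneg _) (Real.abs_sin_le_one θ)
    refine (mul_le_of_le_one_left (norm_nonneg _) hcs).trans ?_
    refine (norm_sum_le _ _).trans (Finset.sum_le_sum fun p _ => ?_)
    refine (norm_sum_le _ _).trans (Finset.sum_le_sum fun q _ => ?_)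
    refine norm_integral_le_of_norm_le ?_ (Filter.Eventually.of_forall fun z => ?_)
    · have h1 : PolyGrowth (fun z => T p q z - C p q) := by
        simpa only [sub_eq_add_neg] using (hT p q).add (PolyGrowth.const _)
      exact PolyGrowth.integrable h1.norm ((hTc p q).sub continuous_const).norm
    · rw [norm_mul]
      exact mul_le_of_le_one_right (norm_nonneg _) (hg2 _ q p)
  have hseg := norm_image_sub_le_of_norm_deriv_le_segment'
    (f := fun t => ∫ z, g (H t z) ∂μ) (a := 0) (b := Real.pi / 2)
    (fun θ _ => (hderiv θ).hasDerivWithinAt) (fun θ _ => hbound θ) (Real.pi / 2)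
    ⟨by positivity, le_rfl⟩
  simp only [hH, Real.cos_zero, Real.sin_zero, Real.cos_pi_div_two, Real.sin_pi_div_two, one_smul,
    zero_smul, add_zero, zero_add, sub_zero, Real.norm_eq_abs] at hseg
  refine hseg.trans ?_
  rw [mul_comm]
  have hpi : Real.pi / 2 ≤ 2 := by linarith [Real.pi_le_four]
  refine mul_le_mul_of_nonneg_right hpi ?_
  exact Finset.sum_nonneg fun p _ => Finset.sum_nonneg fun q _ =>
    integral_nonneg fun z => abs_nonneg _

end SecondOrder

section Cycle

variable {α : Type*} [Fintype α]

lemma sum_sum_sum_sum_rotate (G : α → α → α → α → ℝ) :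
    ∑ a, ∑ b, ∑ c, ∑ e, G a b c e = ∑ b, ∑ c, ∑ e, ∑ a, G a b c e := by
  rw [Finset.sum_comm]
  refine Finset.sum_congr rfl fun b _ => ?_
  rw [Finset.sum_comm]
  refine Finset.sum_congr rfl fun c _ => ?_
  rw [Finset.sum_comm]

lemma sum_path_le {B : α → α → ℝ} {K : ℝ} (hB : ∀ a b, 0 ≤ B a b) (hK : 0 ≤ K)
    (hrow : ∀ a, ∑ b, B a b ≤ K) :
    ∑ a, ∑ b, ∑ c, ∑ e, B a b * B b c * B c e ≤ Fintype.card α * K ^ 3 := by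
  have h1 : ∀ a b c, ∑ e, B a b * B b c * B c e ≤ B a b * B b c * K := fun a b c => by
    rw [← Finset.mul_sum]
    exact mul_le_mul_of_nonneg_left (hrow c) (mul_nonneg (hB _ _) (hB _ _))
  have h2 : ∀ a b, ∑ c, ∑ e, B a b * B b c * B c e ≤ B a b * K ^ 2 := fun a b => by
    refine (Finset.sum_le_sum fun c _ => h1 a b c).trans ?_
    rw [← Finset.sum_mul, ← Finset.mul_sum, mul_assoc, sq]
    exact mul_le_mul_of_nonneg_left (mul_le_mul_of_nonneg_right (hrow b) hK) (hB _ _)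
  have h3 : ∀ a, ∑ b, ∑ c, ∑ e, B a b * B b c * B c e ≤ K ^ 3 := fun a => by
    refine (Finset.sum_le_sum fun b _ => h2 a b).trans ?_
    rw [← Finset.sum_mul, pow_succ' K 2]
    exact mul_le_mul_of_nonneg_right (hrow a) (by positivity)
  refine (Finset.sum_le_sum fun a _ => h3 a).trans ?_
  simp

lemma mul_four_le_rpow {x y z w : ℝ} (hx : 0 ≤ x) (hy : 0 ≤ y) (hz : 0 ≤ z) (hw : 0 ≤ w) :
    x * y * z * w ≤ (1 / 4) * (x ^ (4 / 3 : ℝ) * y ^ (4 / 3 : ℝ) * z ^ (4 / 3 : ℝ) +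
      y ^ (4 / 3 : ℝ) * z ^ (4 / 3 : ℝ) * w ^ (4 / 3 : ℝ) +
      z ^ (4 / 3 : ℝ) * w ^ (4 / 3 : ℝ) * x ^ (4 / 3 : ℝ) +
      w ^ (4 / 3 : ℝ) * x ^ (4 / 3 : ℝ) * y ^ (4 / 3 : ℝ)) := by
  have key : ∀ {t : ℝ}, 0 ≤ t → ∃ u : ℝ, t = u ^ 3 ∧ t ^ (4 / 3 : ℝ) = u ^ 4 := fun {t} ht => by
    refine ⟨t ^ (1 / 3 : ℝ), ?_, ?_⟩
    · rw [← Real.rpow_natCast, ← Real.rpow_mul ht]; norm_num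
    · rw [← Real.rpow_natCast, ← Real.rpow_mul ht]; norm_num
  obtain ⟨a, hxa, hxa'⟩ := key hx
  obtain ⟨b, hyb, hyb'⟩ := key hy
  obtain ⟨c, hzc, hzc'⟩ := key hz
  obtain ⟨e, hwe, hwe'⟩ := key hw
  rw [hxa', hyb', hzc', hwe', hxa, hyb, hzc, hwe]
  nlinarith [sq_nonneg ((a * b * c) ^ 2 - (b * c * e) ^ 2),
    sq_nonneg ((c * e * a) ^ 2 - (e * a * b) ^ 2),
    sq_nonneg ((a * b * c) * (b * c * e) - (c * e * a) * (e * a * b))]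

lemma sum_cycle_le {F : α → α → ℝ} {K : ℝ} (hF : ∀ a b, 0 ≤ F a b) (hK : 0 ≤ K)
    (hrow : ∀ a, ∑ b, F a b ^ (4 / 3 : ℝ) ≤ K) :
    ∑ a, ∑ b, ∑ c, ∑ e, F a b * F b c * F c e * F e a ≤ Fintype.card α * K ^ 3 := by
  set B : α → α → ℝ := fun a b => F a b ^ (4 / 3 : ℝ) with hB
  have hP := sum_path_le (B := B) (fun a b => Real.rpow_nonneg (hF a b) _) hK hrow
  have e1 : ∑ a, ∑ b, ∑ c, ∑ e, B b c * B c e * B e a = ∑ a, ∑ b, ∑ c, ∑ e,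
      B a b * B b c * B c e := by
    rw [sum_sum_sum_sum_rotate]
  have e2 : ∑ a, ∑ b, ∑ c, ∑ e, B c e * B e a * B a b = ∑ a, ∑ b, ∑ c, ∑ e,
      B a b * B b c * B c e := by
    rw [sum_sum_sum_sum_rotate, sum_sum_sum_sum_rotate]
  have e3 : ∑ a, ∑ b, ∑ c, ∑ e, B e a * B a b * B b c = ∑ a, ∑ b, ∑ c, ∑ e,
      B a b * B b c * B c e := by
    rw [sum_sum_sum_sum_rotate, sum_sum_sum_sum_rotate, sum_sum_sum_sum_rotate]
  calc ∑ a, ∑ b, ∑ c, ∑ e, F a b * F b c * F c e * F e a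
      ≤ ∑ a, ∑ b, ∑ c, ∑ e, (1 / 4) * (B a b * B b c * B c e + B b c * B c e * B e a +
          B c e * B e a * B a b + B e a * B a b * B b c) := by
        refine Finset.sum_le_sum fun a _ => Finset.sum_le_sum fun b _ =>
          Finset.sum_le_sum fun c _ => Finset.sum_le_sum fun e _ => ?_
        exact mul_four_le_rpow (hF _ _) (hF _ _) (hF _ _) (hF _ _)
    _ = (1 / 4) * (∑ a, ∑ b, ∑ c, ∑ e, B a b * B b c * B c e +
          ∑ a, ∑ b, ∑ c, ∑ e, B b c * B c e * B e a +
          ∑ a, ∑ b, ∑ c, ∑ e, B c e * B e a * B a b +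
          ∑ a, ∑ b, ∑ c, ∑ e, B e a * B a b * B b c) := by
        simp only [← Finset.mul_sum, Finset.sum_add_distrib]
    _ ≤ Fintype.card α * K ^ 3 := by
        rw [e1, e2, e3]
        linarith

end Cycle

section Wishart

variable {α δ κ : Type*} [Fintype δ]

/-- Half-vector of a shifted sample covariance matrix built from linear functionals `ξ i k`. -/
def shiftedGram (ξ : α → δ → E →L[ℝ] ℝ) (r : α → α → ℝ) (s : δ → δ → ℝ) (c : ℝ) (a b : κ → α)
    (z : E) (p : κ) : ℝ :=
  c * ∑ k, (ξ (a p) k z * ξ (b p) k z - r (a p) (b p) * s k k)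

/-- A centered bilinear form of two rows of linear functionals `ξ i k`, with weights `s`. -/
def gramRemainder (ξ : α → δ → E →L[ℝ] ℝ) (r : α → α → ℝ) (s : δ → δ → ℝ) (c : ℝ) (j v : α)
    (z : E) : ℝ :=
  c ^ 2 * ∑ k, ∑ l, s k l * (ξ j k z * ξ v l z - r j v * s k l)

/-- The Stein kernel of `shiftedGram`. -/
def gramKernel (ξ : α → δ → E →L[ℝ] ℝ) (r : α → α → ℝ) (s : δ → δ → ℝ) (c : ℝ) (a b : κ → α)
    (p q : κ) (z : E) : ℝ :=
  c ^ 2 * ∑ k, ∑ l, s k l *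
    (r (a p) (b q) * (ξ (b p) k z * ξ (a q) l z) + r (a p) (a q) * (ξ (b p) k z * ξ (b q) l z))

variable {ξ : α → δ → E →L[ℝ] ℝ} {r : α → α → ℝ} {s : δ → δ → ℝ}

omit [MeasurableSpace E] [BorelSpace E] [CompleteSpace E] [SecondCountableTopology E] in
lemma c1PolyGrowth_dual_mul_dual_sub (ℓ₁ ℓ₂ : E →L[ℝ] ℝ) (x : ℝ) :
    C1PolyGrowth (fun z => ℓ₁ z * ℓ₂ z - x) := by
  simpa only [sub_eq_add_neg] using ((C1PolyGrowth.continuousLinearMap ℓ₁).mul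
    (C1PolyGrowth.continuousLinearMap ℓ₂)).add (C1PolyGrowth.const _)

omit [MeasurableSpace E] [BorelSpace E] [CompleteSpace E] [SecondCountableTopology E] in
lemma c1PolyGrowth_shiftedGram [Fintype κ] (c : ℝ) (a b : κ → α) :
    C1PolyGrowth (shiftedGram ξ r s c a b) :=
  C1PolyGrowth.pi fun _ => (C1PolyGrowth.const c).mul
    (C1PolyGrowth.sum _ fun _ _ => c1PolyGrowth_dual_mul_dual_sub _ _ _)

omit [MeasurableSpace E] [BorelSpace E] [CompleteSpace E] [SecondCountableTopology E] in
lemma c1PolyGrowth_gramRemainder (c : ℝ) (j v : α) :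
    C1PolyGrowth (gramRemainder ξ r s c j v) :=
  (C1PolyGrowth.const _).mul (C1PolyGrowth.sum _ fun _ _ => C1PolyGrowth.sum _ fun _ _ =>
    (C1PolyGrowth.const _).mul (c1PolyGrowth_dual_mul_dual_sub _ _ _))

omit [MeasurableSpace E] [BorelSpace E] [CompleteSpace E] [SecondCountableTopology E] in
lemma c1PolyGrowth_gramKernel (c : ℝ) (a b : κ → α) (p q : κ) :
    C1PolyGrowth (gramKernel ξ r s c a b p q) :=
  (C1PolyGrowth.const _).mul (C1PolyGrowth.sum _ fun _ _ => C1PolyGrowth.sum _ fun _ _ =>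
    (C1PolyGrowth.const _).mul (((C1PolyGrowth.const _).mul
      ((C1PolyGrowth.continuousLinearMap _).mul (C1PolyGrowth.continuousLinearMap _))).add
      ((C1PolyGrowth.const _).mul
      ((C1PolyGrowth.continuousLinearMap _).mul (C1PolyGrowth.continuousLinearMap _)))))

omit [MeasurableSpace E] [BorelSpace E] [CompleteSpace E] [SecondCountableTopology E] in
lemma fderiv_shiftedGram_apply [Fintype κ] (c : ℝ) (a b : κ → α) (z w : E) (p : κ) :
    fderiv ℝ (shiftedGram ξ r s c a b) z w p =
      c * ∑ k, (ξ (a p) k z * ξ (b p) k w + ξ (a p) k w * ξ (b p) k z) := by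
  have h : HasFDerivAt (fun z => shiftedGram ξ r s c a b z p)
      (c • ∑ k, (ξ (a p) k z • ξ (b p) k + ξ (b p) k z • ξ (a p) k)) z := by
    refine (HasFDerivAt.fun_sum fun k _ => ?_).const_mul c
    exact (((ξ (a p) k).hasFDerivAt).mul ((ξ (b p) k).hasFDerivAt)).sub_const _
  have h2 := (hasFDerivAt_pi'.1
    ((c1PolyGrowth_shiftedGram (ξ := ξ) (r := r) (s := s) c a b).differentiable z).hasFDerivAt) p
  have h3 := congrArg (fun L : E →L[ℝ] ℝ => L w) (h2.unique h)
  simp only [ContinuousLinearMap.coe_comp, Function.comp_apply,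
    ContinuousLinearMap.proj_apply] at h3
  rw [h3]
  simp [mul_comm]

omit [NormedAddCommGroup E] [NormedSpace ℝ E] [BorelSpace E] [CompleteSpace E]
  [SecondCountableTopology E] [IsGaussian μ] in
lemma sq_integral_abs_le [IsProbabilityMeasure μ] {f : E → ℝ} (hf : Integrable (fun z => f z ^ 2) μ)
    (hm : AEStronglyMeasurable f μ) : (∫ z, |f z| ∂μ) ^ 2 ≤ ∫ z, f z ^ 2 ∂μ := by
  have h2 : MemLp (fun z => |f z|) 2 μ := ((memLp_two_iff_integrable_sq hm).2 hf).norm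
  have h := variance_nonneg (fun z => |f z|) μ
  rw [variance_eq_sub h2] at h
  simp only [Pi.pow_apply, sq_abs] at h
  linarith

lemma integral_sq_gramRemainder_le (hμ : ∫ x, x ∂μ = 0) (hr : ∀ i j, |r i j| ≤ 1)
    (hs : ∀ k l, s k l = s l k)
    (hcov : ∀ i j k l, ∫ z, ξ i k z * ξ j l z ∂μ = r i j * s k l) {K : ℝ} (hK : 0 ≤ K)
    (hrow : ∀ k, ∑ l, |s k l| ^ (4 / 3 : ℝ) ≤ K) (c : ℝ) (j v : α) :
    ∫ z, gramRemainder ξ r s c j v z ^ 2 ∂μ ≤ 2 * c ^ 4 * (Fintype.card δ * K ^ 3) := by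
  have hexp : ∀ z, gramRemainder ξ r s c j v z ^ 2 =
      ∑ k, ∑ l, ∑ k', ∑ l', (c ^ 4 * (s k l * s k' l')) *
        ((ξ j k z * ξ v l z - ∫ y, ξ j k y * ξ v l y ∂μ) *
          (ξ j k' z * ξ v l' z - ∫ y, ξ j k' y * ξ v l' y ∂μ)) := by
    intro z
    simp only [gramRemainder, hcov]
    rw [mul_pow, sq (∑ k, _)]
    simp only [Finset.sum_mul]
    simp only [Finset.mul_sum]
    refine Finset.sum_congr rfl fun k _ => Finset.sum_congr rfl fun l _ =>
      Finset.sum_congr rfl fun k' _ => Finset.sum_congr rfl fun l' _ => ?_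
    ring
  have hinteg : ∀ k l k' l', Integrable (fun z => (c ^ 4 * (s k l * s k' l')) *
        ((ξ j k z * ξ v l z - ∫ y, ξ j k y * ξ v l y ∂μ) *
          (ξ j k' z * ξ v l' z - ∫ y, ξ j k' y * ξ v l' y ∂μ))) μ := fun k l k' l' =>
    PolyGrowth.integrable ((PolyGrowth.const _).mul
      ((c1PolyGrowth_dual_mul_dual_sub _ _ _).polyGrowth.mul
        (c1PolyGrowth_dual_mul_dual_sub _ _ _).polyGrowth)) (by fun_prop)
  have hval : ∫ z, gramRemainder ξ r s c j v z ^ 2 ∂μ =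
      ∑ k, ∑ l, ∑ k', ∑ l', (c ^ 4 * (s k l * s k' l')) *
        ((r j j * s k k') * (r v v * s l l') + (r j v * s k l') * (r v j * s l k')) := by
    simp_rw [hexp]
    rw [integral_finsetSum _ fun k _ => integrable_finsetSum _ fun l _ =>
      integrable_finsetSum _ fun k' _ => integrable_finsetSum _ fun l' _ => hinteg k l k' l']
    refine Finset.sum_congr rfl fun k _ => ?_
    rw [integral_finsetSum _ fun l _ =>
      integrable_finsetSum _ fun k' _ => integrable_finsetSum _ fun l' _ => hinteg k l k' l']
    refine Finset.sum_congr rfl fun l _ => ?_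
    rw [integral_finsetSum _ fun k' _ => integrable_finsetSum _ fun l' _ => hinteg k l k' l']
    refine Finset.sum_congr rfl fun k' _ => ?_
    rw [integral_finsetSum _ fun l' _ => hinteg k l k' l']
    refine Finset.sum_congr rfl fun l' _ => ?_
    rw [integral_const_mul, integral_dual_mul_dual_sub_mul_dual_mul_dual_sub hμ]
    simp only [hcov]
  have hcyc := sum_cycle_le (F := fun k l => |s k l|) (fun _ _ => abs_nonneg _) hK hrow
  have hrr : ∀ i j i' j', |r i j * r i' j'| ≤ 1 := fun i j i' j' => by
    rw [abs_mul]
    exact mul_le_one₀ (hr _ _) (abs_nonneg _) (hr _ _)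
  have hmul : ∀ {x y : ℝ}, |x| ≤ 1 → x * y ≤ |y| := fun {x y} hx => by
    refine (le_abs_self _).trans ?_
    rw [abs_mul]
    exact mul_le_of_le_one_left (abs_nonneg _) hx
  have hswap : ∑ k, ∑ l, ∑ k', ∑ l', |s k l| * |s l l'| * |s l' k'| * |s k' k| =
      ∑ k, ∑ l, ∑ l', ∑ k', |s k l| * |s l l'| * |s l' k'| * |s k' k| :=
    Finset.sum_congr rfl fun k _ => Finset.sum_congr rfl fun l _ => Finset.sum_comm
  rw [hval]
  calc ∑ k, ∑ l, ∑ k', ∑ l', (c ^ 4 * (s k l * s k' l')) *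
        ((r j j * s k k') * (r v v * s l l') + (r j v * s k l') * (r v j * s l k'))
      ≤ ∑ k, ∑ l, ∑ k', ∑ l', c ^ 4 * (|s k l| * |s l l'| * |s l' k'| * |s k' k| +
          |s k l| * |s l k'| * |s k' l'| * |s l' k|) := by
        refine Finset.sum_le_sum fun k _ => Finset.sum_le_sum fun l _ =>
          Finset.sum_le_sum fun k' _ => Finset.sum_le_sum fun l' _ => ?_
        have h1 := hmul (y := s k l * s l l' * s l' k' * s k' k) (hrr j j v v)
        have h2 := hmul (y := s k l * s l k' * s k' l' * s l' k) (hrr j v v j)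
        simp only [abs_mul] at h1 h2
        have hc : 0 ≤ c ^ 4 := by positivity
        have h3 := mul_le_mul_of_nonneg_left (add_le_add h1 h2) hc
        refine le_trans (le_of_eq ?_) h3
        rw [hs l' k', hs k' k, hs l' k, mul_assoc]
        congr 1
        ring
    _ = c ^ 4 * (∑ k, ∑ l, ∑ k', ∑ l', |s k l| * |s l l'| * |s l' k'| * |s k' k| +
          ∑ k, ∑ l, ∑ k', ∑ l', |s k l| * |s l k'| * |s k' l'| * |s l' k|) := by
        simp only [← Finset.mul_sum, Finset.sum_add_distrib]
    _ ≤ c ^ 4 * (Fintype.card δ * K ^ 3 + Fintype.card δ * K ^ 3) := by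
        rw [hswap]
        gcongr
    _ = _ := by ring

lemma integral_abs_gramRemainder_le (hμ : ∫ x, x ∂μ = 0) (hr : ∀ i j, |r i j| ≤ 1)
    (hs : ∀ k l, s k l = s l k)
    (hcov : ∀ i j k l, ∫ z, ξ i k z * ξ j l z ∂μ = r i j * s k l) {K : ℝ} (hK : 0 ≤ K)
    (hrow : ∀ k, ∑ l, |s k l| ^ (4 / 3 : ℝ) ≤ K) (c : ℝ) (j v : α) :
    ∫ z, |gramRemainder ξ r s c j v z| ∂μ ≤ √(2 * c ^ 4 * (Fintype.card δ * K ^ 3)) := by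
  have hQ := c1PolyGrowth_gramRemainder (ξ := ξ) (r := r) (s := s) c j v
  refine Real.le_sqrt_of_sq_le ((sq_integral_abs_le ?_ ?_).trans
    (integral_sq_gramRemainder_le hμ hr hs hcov hK hrow c j v))
  · exact PolyGrowth.integrable (hQ.polyGrowth.pow 2) (hQ.continuous.pow 2)
  · exact hQ.continuous.aestronglyMeasurable

section Stein

variable [Fintype κ] [DecidableEq κ] {η : κ → E →L[ℝ] ℝ} {c : ℝ} {a b : κ → α}

omit [MeasurableSpace E] [BorelSpace E] [CompleteSpace E] [SecondCountableTopology E]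
  [DecidableEq κ] in
lemma c1PolyGrowth_path (θ : ℝ) : C1PolyGrowth (fun z =>
    Real.cos θ • (fun p => η p z) + Real.sin θ • shiftedGram ξ r s c a b z) :=
  C1PolyGrowth.pi fun p => ((C1PolyGrowth.const (Real.cos θ)).mul
    (C1PolyGrowth.continuousLinearMap (η p))).add ((C1PolyGrowth.const (Real.sin θ)).mul
      ((C1PolyGrowth.continuousLinearMap (ContinuousLinearMap.proj (R := ℝ) p)).comp
        (c1PolyGrowth_shiftedGram (ξ := ξ) (r := r) (s := s) c a b)))

omit [MeasurableSpace E] [BorelSpace E] [CompleteSpace E] [SecondCountableTopology E] in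
lemma fderiv_comp_path_apply {f : (κ → ℝ) → ℝ} (hf : C1PolyGrowth f) (θ : ℝ) (z w : E) :
    fderiv ℝ (fun z => f (Real.cos θ • (fun p => η p z) +
      Real.sin θ • shiftedGram ξ r s c a b z)) z w =
    ∑ q, (Real.cos θ * η q w + Real.sin θ * (c * ∑ l, (ξ (a q) l z * ξ (b q) l w +
        ξ (a q) l w * ξ (b q) l z))) *
      fderiv ℝ f (Real.cos θ • (fun p => η p z) +
        Real.sin θ • shiftedGram ξ r s c a b z) (Pi.single q 1) := by
  have hΦ := (c1PolyGrowth_shiftedGram (ξ := ξ) (r := r) (s := s) c a b).differentiable z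
  have hY : HasFDerivAt (fun z p => η p z) (ContinuousLinearMap.pi η) z :=
    (ContinuousLinearMap.pi η).hasFDerivAt
  have hH := (hY.const_smul (Real.cos θ)).add (hΦ.hasFDerivAt.const_smul (Real.sin θ))
  have h := (hf.differentiable _).hasFDerivAt.comp z hH
  rw [show fderiv ℝ (fun z => f (Real.cos θ • (fun p => η p z) +
      Real.sin θ • shiftedGram ξ r s c a b z)) z = _ from h.fderiv,
    ContinuousLinearMap.comp_apply, clm_pi_apply_eq_sum]
  refine Finset.sum_congr rfl fun q _ => ?_
  simp [fderiv_shiftedGram_apply]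

lemma integral_linear_mul_comp_path (hμ : ∫ x, x ∂μ = 0)
    (hcross : ∀ p i k, ∫ z, η p z * ξ i k z ∂μ = 0) (p : κ) {f : (κ → ℝ) → ℝ}
    (hf : C1PolyGrowth f) (θ : ℝ) :
    ∫ z, η p z * f (Real.cos θ • (fun p => η p z) + Real.sin θ • shiftedGram ξ r s c a b z) ∂μ =
      Real.cos θ * ∑ q, ∫ z, (∫ y, η p y * η q y ∂μ) *
        fderiv ℝ f (Real.cos θ • (fun p => η p z) + Real.sin θ • shiftedGram ξ r s c a b z)
          (Pi.single q 1) ∂μ := by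
  have hH := c1PolyGrowth_path (ξ := ξ) (r := r) (s := s) (η := η) (c := c) (a := a) (b := b) θ
  rw [integral_dual_mul_eq_integral_fderiv hμ (η p) (hf.comp hH)]
  simp_rw [fderiv_comp_path_apply hf, dual_apply_integral_smul, hcross]
  rw [integral_finsetSum, Finset.mul_sum]
  · refine Finset.sum_congr rfl fun q _ => ?_
    simp only [mul_zero, zero_mul, add_zero, Finset.sum_const_zero, mul_assoc]
    rw [integral_const_mul]
  · intro q _
    simp only [mul_zero, zero_mul, add_zero, Finset.sum_const_zero]
    exact PolyGrowth.integrable ((PolyGrowth.const _).mul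
        ((hf.2.comp hH.polyGrowth).clm_apply (PolyGrowth.const _)))
      (continuous_const.mul ((hf.continuous_fderiv.comp hH.continuous).clm_apply
        continuous_const))

lemma integral_shiftedGram_mul_comp_path (hμ : ∫ x, x ∂μ = 0)
    (hcov : ∀ i j k l, ∫ z, ξ i k z * ξ j l z ∂μ = r i j * s k l)
    (hcross : ∀ p i k, ∫ z, ξ i k z * η p z ∂μ = 0) (p : κ) {f : (κ → ℝ) → ℝ}
    (hf : C1PolyGrowth f) (θ : ℝ) :
    ∫ z, shiftedGram ξ r s c a b z p *
        f (Real.cos θ • (fun p => η p z) + Real.sin θ • shiftedGram ξ r s c a b z) ∂μ =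
      Real.sin θ * ∑ q, ∫ z, gramKernel ξ r s c a b p q z *
        fderiv ℝ f (Real.cos θ • (fun p => η p z) + Real.sin θ • shiftedGram ξ r s c a b z)
          (Pi.single q 1) ∂μ := by
  have hH := c1PolyGrowth_path (ξ := ξ) (r := r) (s := s) (η := η) (c := c) (a := a) (b := b) θ
  have hfH := hf.comp hH
  have hi1 : ∀ k, Integrable (fun z => c * ((ξ (a p) k z * ξ (b p) k z - r (a p) (b p) * s k k) *
      f (Real.cos θ • (fun p => η p z) + Real.sin θ • shiftedGram ξ r s c a b z))) μ := fun k =>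
    ((((c1PolyGrowth_dual_mul_dual_sub _ _ _).mul hfH).polyGrowth).integrable
      ((c1PolyGrowth_dual_mul_dual_sub _ _ _).mul hfH).continuous).const_mul c
  have hi2 : ∀ q, Integrable (fun z => gramKernel ξ r s c a b p q z *
        fderiv ℝ f (Real.cos θ • (fun p => η p z) + Real.sin θ • shiftedGram ξ r s c a b z)
          (Pi.single q 1)) μ := fun q =>
    PolyGrowth.integrable ((c1PolyGrowth_gramKernel c a b p q).polyGrowth.mul
        ((hf.2.comp hH.polyGrowth).clm_apply (PolyGrowth.const _)))
      ((c1PolyGrowth_gramKernel c a b p q).continuous.mul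
        ((hf.continuous_fderiv.comp hH.continuous).clm_apply continuous_const))
  have hi3 : ∀ k, Integrable (fun z => c * (ξ (b p) k z * fderiv ℝ (fun z =>
      f (Real.cos θ • (fun p => η p z) + Real.sin θ • shiftedGram ξ r s c a b z)) z
        (∫ y, ξ (a p) k y • y ∂μ))) μ := fun k =>
    (PolyGrowth.integrable ((PolyGrowth.continuousLinearMap _).mul
      (hfH.2.clm_apply (PolyGrowth.const _)))
      ((ContinuousLinearMap.continuous _).mul
        (hfH.continuous_fderiv.clm_apply continuous_const))).const_mul c
  have hlhs : ∀ z, shiftedGram ξ r s c a b z p *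
      f (Real.cos θ • (fun p => η p z) + Real.sin θ • shiftedGram ξ r s c a b z) =
      ∑ k, c * ((ξ (a p) k z * ξ (b p) k z - r (a p) (b p) * s k k) *
        f (Real.cos θ • (fun p => η p z) + Real.sin θ • shiftedGram ξ r s c a b z)) := by
    intro z
    rw [← Finset.mul_sum, ← Finset.sum_mul, ← mul_assoc]
    rfl
  simp_rw [hlhs]
  rw [integral_finsetSum _ fun k _ => hi1 k, ← integral_finsetSum _ fun q _ => hi2 q,
    ← integral_const_mul]
  have hstep : ∀ k, ∫ z, c * ((ξ (a p) k z * ξ (b p) k z - r (a p) (b p) * s k k) *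
      f (Real.cos θ • (fun p => η p z) + Real.sin θ • shiftedGram ξ r s c a b z)) ∂μ =
      ∫ z, c * (ξ (b p) k z * fderiv ℝ (fun z =>
        f (Real.cos θ • (fun p => η p z) + Real.sin θ • shiftedGram ξ r s c a b z)) z
        (∫ y, ξ (a p) k y • y ∂μ)) ∂μ := by
    intro k
    rw [integral_const_mul, integral_const_mul,
      ← integral_dual_mul_dual_sub_mul hμ (ξ (a p) k) (ξ (b p) k) hfH, hcov]
  simp_rw [hstep]
  rw [← integral_finsetSum _ fun k _ => hi3 k]
  refine integral_congr_ae (Filter.Eventually.of_forall fun z => ?_)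
  simp only [fderiv_comp_path_apply hf, dual_apply_integral_smul, hcross, hcov, gramKernel]
  simp only [Finset.mul_sum, Finset.sum_mul]
  rw [Finset.sum_comm]
  refine Finset.sum_congr rfl fun q _ => Finset.sum_congr rfl fun k _ => ?_
  simp only [mul_zero, zero_add, Finset.mul_sum, Finset.sum_mul]
  refine Finset.sum_congr rfl fun l _ => ?_
  ring

/-- Quantitative comparison between a shifted Gram matrix and the Gaussian vector with the same
covariance, for `C²` test functions with bounded second derivatives. -/
theorem abs_integral_shiftedGram_sub_le (hμ : ∫ x, x ∂μ = 0) (hr : ∀ i j, |r i j| ≤ 1)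
    (hs : ∀ k l, s k l = s l k)
    (hcov : ∀ i j k l, ∫ z, ξ i k z * ξ j l z ∂μ = r i j * s k l)
    (hcross : ∀ p i k, ∫ z, ξ i k z * η p z ∂μ = 0)
    (hη : ∀ p q, ∫ z, η p z * η q z ∂μ =
      (r (a p) (a q) * r (b p) (b q) + r (a p) (b q) * r (b p) (a q)) *
        (c ^ 2 * ∑ k, ∑ l, s k l ^ 2))
    {K : ℝ} (hK : 0 ≤ K) (hrow : ∀ k, ∑ l, |s k l| ^ (4 / 3 : ℝ) ≤ K)
    {g : (κ → ℝ) → ℝ} (hg : ContDiff ℝ 2 g)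
    (hg2 : ∀ x p q, |fderiv ℝ (fun y => fderiv ℝ g y (Pi.single q 1)) x (Pi.single p 1)| ≤ 1) :
    |∫ z, g (shiftedGram ξ r s c a b z) ∂μ - ∫ z, g (fun p => η p z) ∂μ| ≤
      4 * Fintype.card κ ^ 2 * √(2 * c ^ 4 * (Fintype.card δ * K ^ 3)) := by
  have hmain := abs_integral_sub_integral_le_of_stein (μ := μ) hg hg2
    (c1PolyGrowth_shiftedGram (ξ := ξ) (r := r) (s := s) c a b)
    (Y := fun z p => η p z) (C1PolyGrowth.continuousLinearMap (ContinuousLinearMap.pi η))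
    (T := gramKernel ξ r s c a b)
    (fun p q => (c1PolyGrowth_gramKernel c a b p q).polyGrowth)
    (fun p q => (c1PolyGrowth_gramKernel c a b p q).continuous)
    (fun p q => ∫ y, η p y * η q y ∂μ)
    (fun p f hf θ => integral_shiftedGram_mul_comp_path hμ hcov hcross p hf θ)
    (fun p f hf θ => integral_linear_mul_comp_path hμ
      (fun p i k => by simpa only [mul_comm] using hcross p i k) p hf θ)
  refine hmain.trans ?_
  set R := √(2 * c ^ 4 * (Fintype.card δ * K ^ 3)) with hR
  have hQ := integral_abs_gramRemainder_le hμ hr hs hcov hK hrow c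
  have hQi : ∀ j v, Integrable (fun z => |gramRemainder ξ r s c j v z|) μ := fun j v =>
    ((c1PolyGrowth_gramRemainder c j v).polyGrowth.integrable
      (c1PolyGrowth_gramRemainder c j v).continuous).norm
  have hpq : ∀ p q, ∫ z, |gramKernel ξ r s c a b p q z - ∫ y, η p y * η q y ∂μ| ∂μ ≤ 2 * R := by
    intro p q
    have hdec : ∀ z, gramKernel ξ r s c a b p q z - ∫ y, η p y * η q y ∂μ =
        r (a p) (b q) * gramRemainder ξ r s c (b p) (a q) z +
          r (a p) (a q) * gramRemainder ξ r s c (b p) (b q) z := by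
      intro z
      rw [hη]
      simp only [gramKernel, gramRemainder, Finset.mul_sum]
      rw [← Finset.sum_sub_distrib, ← Finset.sum_add_distrib]
      refine Finset.sum_congr rfl fun k _ => ?_
      rw [← Finset.sum_sub_distrib, ← Finset.sum_add_distrib]
      refine Finset.sum_congr rfl fun l _ => ?_
      ring
    calc ∫ z, |gramKernel ξ r s c a b p q z - ∫ y, η p y * η q y ∂μ| ∂μ
        ≤ ∫ z, (|gramRemainder ξ r s c (b p) (a q) z| +
            |gramRemainder ξ r s c (b p) (b q) z|) ∂μ := by
          refine integral_mono_of_nonneg (Filter.Eventually.of_forall fun z => abs_nonneg _)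
            ((hQi _ _).add (hQi _ _)) (Filter.Eventually.of_forall fun z => ?_)
          simp only [hdec]
          refine (abs_add_le _ _).trans (add_le_add ?_ ?_)
          · rw [abs_mul]
            exact mul_le_of_le_one_left (abs_nonneg _) (hr _ _)
          · rw [abs_mul]
            exact mul_le_of_le_one_left (abs_nonneg _) (hr _ _)
      _ = _ := integral_add (hQi _ _) (hQi _ _)
      _ ≤ R + R := add_le_add (hQ _ _) (hQ _ _)
      _ = 2 * R := by ring
  calc 2 * ∑ p, ∑ q, ∫ z, |gramKernel ξ r s c a b p q z - ∫ y, η p y * η q y ∂μ| ∂μ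
      ≤ 2 * ∑ _p : κ, ∑ _q : κ, 2 * R := by
        gcongr with p _ q _
        exact hpq p q
    _ = _ := by
        simp
        ring

end Stein

end Wishart

end Gaussian

namespace IsCenteredGaussianFamily

variable {Ω : Type*} [MeasureSpace Ω] {ι : Type*} {X : ι → Ω → ℝ}

lemma exists_map_eq (hX : IsCenteredGaussianFamily X) (i : ι) :
    ∃ v : NNReal, Measure.map (X i) volume = gaussianReal 0 v := by
  simpa using hX {i} 1

lemma aemeasurable (hX : IsCenteredGaussianFamily X) (i : ι) : AEMeasurable (X i) := by
  obtain ⟨v, hv⟩ := hX.exists_map_eq i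
  by_contra h
  rw [Measure.map_of_not_aemeasurable h] at hv
  exact IsProbabilityMeasure.ne_zero (gaussianReal 0 v) hv.symm

variable [Fintype ι]

lemma aemeasurable_pi (hX : IsCenteredGaussianFamily X) : AEMeasurable (fun ω i => X i ω) :=
  aemeasurable_pi_lambda _ hX.aemeasurable

lemma isGaussian_map (hX : IsCenteredGaussianFamily X) :
    IsGaussian (Measure.map (fun ω i => X i ω) volume) := by
  classical
  refine isGaussian_of_map_eq_gaussianReal fun L => ?_
  obtain ⟨v, hv⟩ := hX Finset.univ fun i => L (Pi.single i 1)
  refine ⟨0, v, ?_⟩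
  rw [← hv, AEMeasurable.map_map_of_aemeasurable (by fun_prop) hX.aemeasurable_pi]
  congr 1
  ext ω
  simp only [Function.comp_apply, mul_comm, clm_pi_apply_eq_sum L fun i => X i ω]

lemma integral_map_id_eq_zero (hX : IsCenteredGaussianFamily X) :
    ∫ x, x ∂(Measure.map (fun ω i => X i ω) volume) = 0 := by
  have := hX.isGaussian_map
  ext i
  have h := (ContinuousLinearMap.proj (R := ℝ) (φ := fun _ : ι => ℝ) i).integral_comp_comm
    (IsGaussian.integrable_id (μ := Measure.map (fun ω i => X i ω) volume))
  simp only [ContinuousLinearMap.proj_apply, id] at h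
  rw [← h, integral_map hX.aemeasurable_pi
    (measurable_pi_apply i).aestronglyMeasurable]
  obtain ⟨v, hv⟩ := hX.exists_map_eq i
  have h2 := integral_map (hX.aemeasurable i) (f := fun x : ℝ => x) (by fun_prop)
  rw [hv, integral_id_gaussianReal] at h2
  simpa using h2.symm

end IsCenteredGaussianFamily

lemma sum_fin_eq_sum_Icc (d : ℕ) (f : ℤ → ℝ) :
    ∑ k ∈ Finset.Icc 1 (d : ℤ), f k = ∑ k : Fin d, f ((k : ℤ) + 1) := by
  symm
  refine Finset.sum_bij (fun k _ => (k : ℤ) + 1) ?_ ?_ ?_ ?_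
  · intro k _
    have := k.2
    simp only [Finset.mem_Icc]
    omega
  · intro k _ l _ h
    ext
    simpa using h
  · intro k hk
    simp only [Finset.mem_Icc] at hk
    exact ⟨⟨(k - 1).toNat, by omega⟩, Finset.mem_univ _, by simp; omega⟩
  · intro k _
    rfl

lemma sum_fin_sub_le_sum_Icc (d : ℕ) {f : ℤ → ℝ} (hf : ∀ k, 0 ≤ f k) (k : Fin d) :
    ∑ l : Fin d, f ((k : ℤ) - (l : ℤ)) ≤ ∑ m ∈ Finset.Icc (-(d : ℤ)) (d : ℤ), f m := by
  have hinj : Set.InjOn (fun l : Fin d => (k : ℤ) - (l : ℤ)) (Finset.univ : Finset (Fin d)) := by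
    intro l _ m _ h
    ext
    simpa using h
  rw [← Finset.sum_image (f := f) hinj]
  refine Finset.sum_le_sum_of_subset_of_nonneg (fun m hm => ?_) fun m _ _ => hf m
  obtain ⟨l, -, rfl⟩ := Finset.mem_image.1 hm
  have := k.2
  have := l.2
  simp only [Finset.mem_Icc]
  omega

lemma card_subtype_prod_le (n : ℕ) :
    Fintype.card {p : Fin n × Fin n // p.1 ≤ p.2} ≤ n ^ 2 := by
  refine (Fintype.card_subtype_le _).trans ?_
  simp [sq]

lemma sqrt_two_mul_le {d : ℕ} (hd : 1 ≤ d) {K : ℝ} (hK : 0 ≤ K) :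
    √(2 * (1 / √d) ^ 4 * (d * K ^ 3)) ≤ 2 * (K ^ (3 / 2 : ℝ) / √d) := by
  have hd' : (0 : ℝ) < d := by exact_mod_cast hd
  have h1 : (1 / √(d : ℝ)) ^ 4 = 1 / (d : ℝ) ^ 2 := by
    rw [show (4 : ℕ) = 2 * 2 from rfl, pow_mul, div_pow, Real.sq_sqrt hd'.le]
    simp
  have h2 : (K ^ (3 / 2 : ℝ)) ^ 2 = K ^ 3 := by
    rw [← Real.rpow_natCast, ← Real.rpow_mul hK, ← Real.rpow_natCast]
    norm_num
  refine Real.sqrt_le_iff.2 ⟨by positivity, ?_⟩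
  rw [h1, mul_pow, div_pow, h2, Real.sq_sqrt hd'.le]
  have h3 : 0 ≤ K ^ 3 / d := by positivity
  calc 2 * (1 / (d : ℝ) ^ 2) * (d * K ^ 3) = 2 * (K ^ 3 / d) := by field_simp
    _ ≤ 2 ^ 2 * (K ^ 3 / d) := by linarith

lemma integral_prod_id_eq_zero {E F : Type*} [NormedAddCommGroup E] [NormedSpace ℝ E]
    [CompleteSpace E] [MeasurableSpace E] [BorelSpace E] [SecondCountableTopology E]
    [NormedAddCommGroup F] [NormedSpace ℝ F] [CompleteSpace F] [MeasurableSpace F] [BorelSpace F]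
    [SecondCountableTopology F] {μ : Measure E} {ν : Measure F} [IsGaussian μ] [IsGaussian ν]
    (hμ : ∫ x, x ∂μ = 0) (hν : ∫ x, x ∂ν = 0) : ∫ z, z ∂(μ.prod ν) = 0 := by
  have hi : Integrable (fun z => z) (μ.prod ν) := IsGaussian.integrable_id
  ext1
  · rw [fst_integral hi, integral_fun_fst (fun x => x), hμ, smul_zero]
    rfl
  · rw [snd_integral hi, integral_fun_snd (fun x => x), hν, smul_zero]
    rfl

/-- **Theorem 4.2, part (1)**: `d₂` bound between the half-vector of the shifted Wishart matrix
with overall correlation `(r, s)` and the Gaussian vector with the same covariance, with rate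
`C n⁴ d^{-1/2} (∑_{|k|≤d} |s(k)|^{4/3})^{3/2}` (no integrability assumption on `r`). -/
theorem shifted_wishart_d2_bound_overall_correlation :
    ∃ C > (0 : ℝ), ∀ (n d : ℕ), 1 ≤ n → 1 ≤ d →
      ∀ (r s : ℤ → ℝ), (∀ k, r (-k) = r k) → (∀ k, s (-k) = s k) →
      r 0 = 1 → s 0 = 1 → (∀ k, |r k| ≤ 1) → Summable (fun k : ℤ => s k ^ 2) →
      ∀ (Ω : Type) [MeasureSpace Ω], IsProbabilityMeasure (volume : Measure Ω) →
      ∀ X : Fin n → Fin d → Ω → ℝ,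
        IsCenteredGaussianFamily (fun p : Fin n × Fin d => X p.1 p.2) →
        (∀ (i j : Fin n) (k l : Fin d),
          ∫ ω, X i k ω * X j l ω = r ((i : ℤ) - (j : ℤ)) * s ((k : ℤ) - (l : ℤ))) →
      ∀ Wt : Fin n → Fin n → Ω → ℝ,
        (∀ i j ω, Wt i j ω =
          (1 / Real.sqrt d) * ∑ k : Fin d, (X i k ω * X j k ω - r ((i : ℤ) - (j : ℤ)))) →
      ∀ G : {p : Fin n × Fin n // p.1 ≤ p.2} → Ω → ℝ,
        IsCenteredGaussianFamily G →
        (∀ (i j u v : Fin n) (hij : i ≤ j) (huv : u ≤ v),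
          ∫ ω, G ⟨(i, j), hij⟩ ω * G ⟨(u, v), huv⟩ ω =
            (r ((i : ℤ) - (u : ℤ)) * r ((v : ℤ) - (j : ℤ))
              + r ((i : ℤ) - (v : ℤ)) * r ((u : ℤ) - (j : ℤ)))
              * ((1 / (d : ℝ)) * ∑ k ∈ Finset.Icc 1 (d : ℤ), ∑ l ∈ Finset.Icc 1 (d : ℤ),
                  s (k - l) ^ 2)) →
      ∀ g : ({p : Fin n × Fin n // p.1 ≤ p.2} → ℝ) → ℝ, ContDiff ℝ 2 g →
        (∀ (x : {p : Fin n × Fin n // p.1 ≤ p.2} → ℝ) (p q : {p : Fin n × Fin n // p.1 ≤ p.2}),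
          |fderiv ℝ (fun y => fderiv ℝ g y (Pi.single q 1)) x (Pi.single p 1)| ≤ 1) →
      |(∫ ω, g (fun p => Wt p.1.1 p.1.2 ω)) - ∫ ω, g (fun p => G p ω)| ≤
        C * (n : ℝ) ^ 4 / Real.sqrt d
          * (∑ k ∈ Finset.Icc (-(d : ℤ)) (d : ℤ), |s k| ^ ((4 : ℝ) / 3)) ^ ((3 : ℝ) / 2) := by
  refine ⟨8, by norm_num, ?_⟩
  intro n d _ hd r s hre hse _ hs0 hr1 _ Ω _ _ X hX hXcov Wt hWt G hG hGcov g hg hg2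
  set K : ℝ := ∑ k ∈ Finset.Icc (-(d : ℤ)) (d : ℤ), |s k| ^ ((4 : ℝ) / 3) with hKdef
  have hK : 0 ≤ K := Finset.sum_nonneg fun _ _ => by positivity
  have hμG := hX.isGaussian_map
  have hνG := hG.isGaussian_map
  have hμ0 := hX.integral_map_id_eq_zero
  have hν0 := hG.integral_map_id_eq_zero
  have hXm := hX.aemeasurable_pi
  have hGm := hG.aemeasurable_pi
  set μ := Measure.map (fun ω (p : Fin n × Fin d) => X p.1 p.2 ω) volume with hμ
  set ν := Measure.map (fun ω p => G p ω) volume with hν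
  let ξ : Fin n → Fin d → ((Fin n × Fin d → ℝ) × ({p : Fin n × Fin n // p.1 ≤ p.2} → ℝ)) →L[ℝ] ℝ :=
    fun i k => ContinuousLinearMap.proj (R := ℝ) (φ := fun _ => ℝ) (i, k) ∘L
      ContinuousLinearMap.fst ℝ _ _
  let η : {p : Fin n × Fin n // p.1 ≤ p.2} →
      ((Fin n × Fin d → ℝ) × ({p : Fin n × Fin n // p.1 ≤ p.2} → ℝ)) →L[ℝ] ℝ :=
    fun p => ContinuousLinearMap.proj (R := ℝ) (φ := fun _ => ℝ) p ∘L
      ContinuousLinearMap.snd ℝ _ _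
  have hd' : (0 : ℝ) < d := by exact_mod_cast hd
  have hcov : ∀ i j k l, ∫ z, ξ i k z * ξ j l z ∂(μ.prod ν) =
      r ((i : ℤ) - (j : ℤ)) * s ((k : ℤ) - (l : ℤ)) := by
    intro i j k l
    rw [← hXcov]
    refine (integral_fun_fst (μ := μ) (ν := ν) fun x => x (i, k) * x (j, l)).trans ?_
    rw [probReal_univ, one_smul, hμ, integral_map hXm (by fun_prop)]
  have hcross : ∀ p i k, ∫ z, ξ i k z * η p z ∂(μ.prod ν) = 0 := by
    intro p i k
    refine (integral_prod_mul (μ := μ) (ν := ν) (fun x => x (i, k)) fun y => y p).trans ?_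
    have h := (ContinuousLinearMap.proj (R := ℝ) (φ := fun _ : Fin n × Fin d => ℝ)
      (i, k)).integral_comp_comm (IsGaussian.integrable_id (μ := μ))
    simp only [ContinuousLinearMap.proj_apply, id] at h
    rw [h, hμ0]
    simp
  have hηη : ∀ p q, ∫ z, η p z * η q z ∂(μ.prod ν) =
      (r ((p.1.1 : ℤ) - (q.1.1 : ℤ)) * r ((p.1.2 : ℤ) - (q.1.2 : ℤ)) +
        r ((p.1.1 : ℤ) - (q.1.2 : ℤ)) * r ((p.1.2 : ℤ) - (q.1.1 : ℤ))) *
        ((1 / √(d : ℝ)) ^ 2 * ∑ k : Fin d, ∑ l : Fin d, s ((k : ℤ) - (l : ℤ)) ^ 2) := by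
    intro p q
    refine (integral_fun_snd (μ := μ) (ν := ν) fun x => x p * x q).trans ?_
    rw [probReal_univ, one_smul, hν, integral_map hGm (by fun_prop)]
    refine (hGcov _ _ _ _ p.2 q.2).trans ?_
    rw [← hre (q.1.2 - p.1.2 : ℤ), ← hre (q.1.1 - p.1.2 : ℤ), neg_sub, neg_sub, div_pow, one_pow,
      Real.sq_sqrt hd'.le]
    simp only [sum_fin_eq_sum_Icc, add_sub_add_right_eq_sub]
  have hmain := abs_integral_shiftedGram_sub_le (μ := μ.prod ν) (ξ := ξ) (η := η)
    (r := fun i j => r ((i : ℤ) - (j : ℤ))) (s := fun k l => s ((k : ℤ) - (l : ℤ)))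
    (c := 1 / √(d : ℝ)) (a := fun p => p.1.1) (b := fun p => p.1.2)
    (integral_prod_id_eq_zero hμ0 hν0) (fun i j => hr1 _)
    (fun k l => by rw [← hse, neg_sub]) hcov hcross hηη hK
    (fun k => sum_fin_sub_le_sum_Icc d (f := fun m => |s m| ^ ((4 : ℝ) / 3))
      (fun m => by positivity) k) hg hg2
  have hintW : ∫ z, g (shiftedGram ξ (fun i j => r ((i : ℤ) - (j : ℤ)))
      (fun k l => s ((k : ℤ) - (l : ℤ))) (1 / √(d : ℝ)) (fun p => p.1.1) (fun p => p.1.2) z)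
      ∂(μ.prod ν) = ∫ ω, g (fun p => Wt p.1.1 p.1.2 ω) := by
    refine (integral_fun_fst (μ := μ) (ν := ν) fun x => g fun p => (1 / √(d : ℝ)) * ∑ k : Fin d,
      (x (p.1.1, k) * x (p.1.2, k) -
        r ((p.1.1 : ℤ) - (p.1.2 : ℤ)) * s ((k : ℤ) - (k : ℤ)))).trans ?_
    rw [probReal_univ, one_smul, hμ, integral_map hXm]
    · simp only [hWt, sub_self, hs0, mul_one]
    · exact (hg.continuous.comp (by fun_prop)).aestronglyMeasurable
  have hintG : ∫ z, g (fun p => η p z) ∂(μ.prod ν) = ∫ ω, g (fun p => G p ω) := by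
    refine (integral_fun_snd (μ := μ) (ν := ν) fun x => g x).trans ?_
    rw [probReal_univ, one_smul, hν, integral_map hGm hg.continuous.aestronglyMeasurable]
  rw [hintW, hintG, Fintype.card_fin] at hmain
  refine hmain.trans ?_
  have hcard : (Fintype.card {p : Fin n × Fin n // p.1 ≤ p.2} : ℝ) ≤ (n : ℝ) ^ 2 := by
    exact_mod_cast card_subtype_prod_le n
  calc 4 * (Fintype.card {p : Fin n × Fin n // p.1 ≤ p.2} : ℝ) ^ 2 *
        √(2 * (1 / √(d : ℝ)) ^ 4 * (d * K ^ 3))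
      ≤ 4 * ((n : ℝ) ^ 2) ^ 2 * (2 * (K ^ (3 / 2 : ℝ) / √d)) := by
        gcongr
        exact sqrt_two_mul_le hd hK
    _ = _ := by ring
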